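/- Any n-gon with n ≥ 7 is a section of a (2 + ⌊n/7⌋)-dimensional polytope with at most ⌈6n/7⌉ vertices: if p_0, …, p_{n−1} ∈ ℝ² (n ≥ 7) are in clockwise convex position and P = conv{p_0, …, p_{n−1}}, then there exist a finite set V ⊆ ℝ^{2+⌊n/7⌋} with |V| ≤ ⌈6n/7⌉ and an injective affine map f : ℝ² → ℝ^{2+⌊n/7⌋} such that conv(V) ∩ range(f) = f(P). In particular, the intersection complexity of P is at most ⌈6n/7⌉. -/

import Mathlib

open Matrix

/-- Homogeneous coordinates of a point in the plane. -/
noncomputable def hat (p : Fin 2 → ℝ) : Fin 3 → ℝ := ![p 0, p 1, 1]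

/-- Determinant of the 3×3 matrix with rows `u`, `v`, `w`. -/
def det3 (u v w : Fin 3 → ℝ) : ℝ := Matrix.det (Matrix.of ![u, v, w])

theorem det3_rotate (u v w : Fin 3 → ℝ) : det3 v w u = det3 u v w := by
  simp [det3, Matrix.det_fin_three]; ring

theorem det3_reverse (u v w : Fin 3 → ℝ) : det3 w v u = -det3 u v w := by
  simp [det3, Matrix.det_fin_three]; ring

/-- The three-term Grassmann–Plücker relation. -/
theorem det3_grassmann_plucker (a b c d e : Fin 3 → ℝ) :
    det3 a b d * det3 a c e = det3 a b c * det3 a d e + det3 a b e * det3 a c d := by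
  simp [det3, Matrix.det_fin_three]; ring

/-- Cramer's rule for the linear dependency among four vectors in space. -/
theorem det3_cramer (a b c w : Fin 3 → ℝ) :
    det3 a b c • w = det3 b c w • a + det3 c a w • b + det3 a b w • c := by
  ext i
  fin_cases i <;> simp [det3, Matrix.det_fin_three] <;> ring

theorem det3_smul_sub_add_smul (a b u v w : Fin 3 → ℝ) (r s t : ℝ) :
    det3 a b (r • u - s • v + t • w) = r * det3 a b u - s * det3 a b v + t * det3 a b w := by
  simp [det3, Matrix.det_fin_three]; ring

theorem det3_self_left (a b : Fin 3 → ℝ) : det3 a b a = 0 := by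
  simp [det3, Matrix.det_fin_three]; ring

theorem det3_self_right (a b : Fin 3 → ℝ) : det3 a b b = 0 := by
  simp [det3, Matrix.det_fin_three]; ring

/-- Vectors in space all of whose ordered triples are positively oriented. -/
def PosOriented {m : ℕ} (x : Fin m → Fin 3 → ℝ) : Prop :=
  ∀ i j k : Fin m, i < j → j < k → 0 < det3 (x i) (x j) (x k)

theorem PosOriented.rotate_one {x : Fin 7 → Fin 3 → ℝ} (hx : PosOriented x) :
    PosOriented fun i => x (i + 1) := by
  intro i j k hij hjk
  by_cases hk : k = 6
  · subst hk
    change 0 < det3 (x (i + 1)) (x (j + 1)) (x 0)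
    rw [det3_rotate]
    exact hx _ _ _ (by revert i j; decide) (by revert i j; decide)
  · exact hx _ _ _ (by revert i j k; decide) (by revert i j k; decide)

theorem PosOriented.rotate {x : Fin 7 → Fin 3 → ℝ} (hx : PosOriented x) (s : Fin 7) :
    PosOriented fun i => x (i + s) := by
  induction s using Fin.induction with
  | zero => simpa using hx
  | succ s ih =>
    have h := ih.rotate_one
    have e : ∀ i : Fin 7, i + 1 + s.castSucc = i + s.succ := by
      intro i; rw [← Fin.coeSucc_eq_succ]; abel
    simpa only [e] using h

/-- If products of consecutive terms of two positive cyclic sequences dominate as indicated, the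
products of the two sequences dominate that of the third. -/
theorem prod_le_prod_of_cyclic {t g h : Fin 7 → ℝ} (ht : ∀ s, 0 < t s) (hg : ∀ s, 0 < g s)
    (hh : ∀ s, 0 < h s) (h₁ : ∀ s, t s * h (1 + s) ≤ g s * g (1 + s))
    (h₂ : ∀ s, t (2 + s) * g s ≤ h s * h (1 + s)) :
    ∏ s, t s ≤ ∏ s, g s ∧ ∏ s, t s ≤ ∏ s, h s := by
  have shift : ∀ (f : Fin 7 → ℝ) (c : Fin 7), ∏ s, f (c + s) = ∏ s, f s :=
    fun f c => Equiv.prod_comp (Equiv.addLeft c) f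
  have p₁ := Finset.prod_le_prod (s := Finset.univ)
    (fun s _ => (mul_pos (ht s) (hh (1 + s))).le) (fun s _ => h₁ s)
  have p₂ := Finset.prod_le_prod (s := Finset.univ)
    (fun s _ => (mul_pos (ht (2 + s)) (hg s)).le) (fun s _ => h₂ s)
  simp only [Finset.prod_mul_distrib, shift] at p₁ p₂
  have hT : 0 < ∏ s, t s := Finset.prod_pos fun s _ => ht s
  have hG : 0 < ∏ s, g s := Finset.prod_pos fun s _ => hg s
  have hH : 0 < ∏ s, h s := Finset.prod_pos fun s _ => hh s
  generalize ∏ s, t s = T at *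
  generalize ∏ s, g s = G at *
  generalize ∏ s, h s = H at *
  constructor <;> by_contra! hlt
  · nlinarith [mul_lt_mul_of_pos_right hlt hG, mul_lt_mul_of_pos_right hlt hT, mul_pos hT hG]
  · nlinarith [mul_lt_mul_of_pos_right hlt hH, mul_lt_mul_of_pos_right hlt hT, mul_pos hT hH]

/-- Seven vectors satisfy this condition if the heptagon that they span is, with the labelling as
given, a section of an octahedron-like polytope with three vertices on each side. -/
def Liftable (x : Fin 7 → Fin 3 → ℝ) : Prop :=
  det3 (x 0) (x 1) (x 2) * det3 (x 4) (x 5) (x 6)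
      ≤ det3 (x 5) (x 6) (x 0) * det3 (x 1) (x 2) (x 4) ∧
    det3 (x 5) (x 6) (x 0) * det3 (x 1) (x 2) (x 3)
      ≤ det3 (x 0) (x 1) (x 2) * det3 (x 3) (x 5) (x 6)

theorem PosOriented.not_both_fail {x : Fin 7 → Fin 3 → ℝ} (hx : PosOriented x)
    (h₁ : det3 (x 0) (x 1) (x 2) * det3 (x 3) (x 5) (x 6)
      < det3 (x 5) (x 6) (x 0) * det3 (x 1) (x 2) (x 3))
    (h₂ : det3 (x 1) (x 2) (x 3) * det3 (x 4) (x 5) (x 0)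
      < det3 (x 3) (x 4) (x 5) * det3 (x 0) (x 1) (x 2)) : False := by
  have gp := det3_grassmann_plucker (x 5) (x 6) (x 0) (x 3) (x 4)
  have e₁ : det3 (x 5) (x 6) (x 3) = det3 (x 3) (x 5) (x 6) := det3_rotate ..
  have e₂ : det3 (x 5) (x 0) (x 4) = det3 (x 4) (x 5) (x 0) := det3_rotate ..
  have e₃ : det3 (x 5) (x 3) (x 4) = det3 (x 3) (x 4) (x 5) := by rw [det3_rotate, det3_rotate]
  have e₄ : det3 (x 5) (x 6) (x 4) = det3 (x 4) (x 5) (x 6) := det3_rotate ..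
  have e₅ : det3 (x 5) (x 0) (x 3) = det3 (x 0) (x 3) (x 5) := by rw [det3_rotate, det3_rotate]
  have e₆ : det3 (x 4) (x 5) (x 0) = det3 (x 0) (x 4) (x 5) := by rw [det3_rotate]
  have e₇ : det3 (x 5) (x 6) (x 0) = det3 (x 0) (x 5) (x 6) := by rw [det3_rotate]
  have p012 := hx 0 1 2 (by decide) (by decide)
  have p123 := hx 1 2 3 (by decide) (by decide)
  have p345 := hx 3 4 5 (by decide) (by decide)
  have p356 := hx 3 5 6 (by decide) (by decide)
  have p045 := hx 0 4 5 (by decide) (by decide)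
  have p456 := hx 4 5 6 (by decide) (by decide)
  have p035 := hx 0 3 5 (by decide) (by decide)
  have p056 := hx 0 5 6 (by decide) (by decide)
  rw [e₁, e₂, e₃, e₄, e₅, e₆, e₇] at gp
  rw [e₇] at h₁
  rw [e₆] at h₂
  have h := mul_lt_mul'' h₁ h₂ (by positivity) (by positivity)
  have h' : det3 (x 0) (x 5) (x 6) * det3 (x 3) (x 4) (x 5)
      ≤ det3 (x 3) (x 5) (x 6) * det3 (x 0) (x 4) (x 5) := by
    rw [gp]; exact le_add_of_nonneg_right (by positivity)
  nlinarith [mul_le_mul_of_nonneg_left h' (mul_pos p012 p123).le]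

theorem PosOriented.exists_liftable {x : Fin 7 → Fin 3 → ℝ} (hx : PosOriented x) :
    ∃ s, Liftable fun i => x (i + s) := by
  by_contra! hno
  let t : Fin 7 → ℝ := fun s => det3 (x s) (x (1 + s)) (x (2 + s))
  let g : Fin 7 → ℝ := fun s => det3 (x s) (x (1 + s)) (x (3 + s))
  let h : Fin 7 → ℝ := fun s => det3 (x s) (x (2 + s)) (x (3 + s))
  have ht : ∀ s, 0 < t s := fun s => by
    simpa [t] using hx.rotate s 0 1 2 (by decide) (by decide)
  have hg : ∀ s, 0 < g s := fun s => by
    simpa [g] using hx.rotate s 0 1 3 (by decide) (by decide)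
  have hh : ∀ s, 0 < h s := fun s => by
    simpa [h] using hx.rotate s 0 2 3 (by decide) (by decide)
  have pos4 : ∀ s, 0 < det3 (x s) (x (1 + s)) (x (4 + s)) := fun s => by
    simpa using hx.rotate s 0 1 4 (by decide) (by decide)
  have pos34 : ∀ s, 0 < det3 (x s) (x (3 + s)) (x (4 + s)) := fun s => by
    simpa using hx.rotate s 0 3 4 (by decide) (by decide)
  obtain ⟨hTG, hTH⟩ := prod_le_prod_of_cyclic ht hg hh
    (fun s => by
      have gp := det3_grassmann_plucker (x (1 + s)) (x (2 + s)) (x (3 + s)) (x (4 + s)) (x s)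
      have h₁ := mul_pos (ht (1 + s)) (pos4 s)
      simp only [t, g, h, ← add_assoc, Fin.isValue, Fin.reduceAdd] at h₁ ⊢
      simp only [det3_rotate (x s)] at gp
      nlinarith)
    (fun s => by
      have gp := det3_grassmann_plucker (x (3 + s)) (x (4 + s)) (x s) (x (1 + s)) (x (2 + s))
      have h₁ := mul_pos (pos34 s) (ht (1 + s))
      simp only [t, g, h, ← add_assoc, Fin.isValue, Fin.reduceAdd] at h₁ ⊢
      have e : ∀ a b, det3 (x (3 + s)) a b = det3 a b (x (3 + s)) :=
        fun a b => (det3_rotate ..).symm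
      rw [e, e, e, e, e, e, ← det3_rotate (x (4 + s)), ← det3_rotate (x (4 + s)),
        ← det3_rotate (x (4 + s))] at gp
      nlinarith)
  have key : ∀ s, t (5 + s) * g (1 + s) < t s * t (4 + s) ∨
      t s * h (3 + s) < t (5 + s) * t (1 + s) := fun s => by
    have := hno s
    simp only [Liftable, not_and_or, not_le] at this
    simpa [t, g, h, ← add_assoc] using this
  have step : ∀ s, t s * h (3 + s) < t (5 + s) * t (1 + s) →
      t (3 + s) * h (3 + (3 + s)) < t (5 + (3 + s)) * t (1 + (3 + s)) := fun s hs => by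
    refine (key (3 + s)).resolve_left fun hs' => (hx.rotate s).not_both_fail ?_ ?_
    · simpa [t, h, ← add_assoc] using hs
    · simpa [t, g, ← add_assoc] using hs'
  have shift : ∀ (f : Fin 7 → ℝ) (c : Fin 7), ∏ s, f (c + s) = ∏ s, f s :=
    fun f c => Equiv.prod_comp (Equiv.addLeft c) f
  have hT : 0 < ∏ s, t s := Finset.prod_pos fun s _ => ht s
  by_cases hex : ∃ s, t s * h (3 + s) < t (5 + s) * t (1 + s)
  · obtain ⟨s, hs⟩ := hex
    have hrs : ∀ r s : Fin 7, (5 * (r - s)).val • 3 + s = r := by decide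
    have all : ∀ m : ℕ, (fun s => t s * h (3 + s) < t (5 + s) * t (1 + s)) (m • 3 + s) := by
      intro m
      induction m with
      | zero => simpa using hs
      | succ m ih =>
        have := step _ ih
        rwa [← add_assoc, add_comm 3, ← succ_nsmul] at this
    have all' : ∀ r, t r * h (3 + r) < t (5 + r) * t (1 + r) := fun r => by
      have := all (5 * (r - s)).val
      rwa [hrs r s] at this
    have := Finset.prod_lt_prod_of_nonempty (s := Finset.univ)
      (fun s _ => mul_pos (ht s) (hh (3 + s))) (fun s _ => all' s) Finset.univ_nonempty
    simp only [Finset.prod_mul_distrib, shift] at this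
    nlinarith
  · push Not at hex
    have := Finset.prod_lt_prod_of_nonempty (s := Finset.univ)
      (fun s _ => mul_pos (ht (5 + s)) (hg (1 + s)))
      (fun s _ => (key s).resolve_right (hex s).not_gt) Finset.univ_nonempty
    simp only [Finset.prod_mul_distrib, shift] at this
    nlinarith

/-- A vector on the inner side of the four facets of the cone over a quadrilateral lies in it. -/
theorem exists_smul_hat_of_det3_nonneg {S : Set (Fin 2 → ℝ)} {a b c d : Fin 2 → ℝ}
    (ha : a ∈ S) (hb : b ∈ S) (hc : c ∈ S) (hd : d ∈ S) {w : Fin 3 → ℝ}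
    (habc : 0 < det3 (hat a) (hat b) (hat c)) (hacd : 0 < det3 (hat a) (hat c) (hat d))
    (hab : 0 ≤ det3 (hat a) (hat b) w) (hbc : 0 < det3 (hat b) (hat c) w)
    (hcd : 0 < det3 (hat c) (hat d) w) (hda : 0 ≤ det3 (hat d) (hat a) w) :
    ∃ r : ℝ, 0 < r ∧ ∃ y ∈ convexHull ℝ S, w = r • hat y := by
  have tri : ∀ a ∈ S, ∀ b ∈ S, ∀ c ∈ S, 0 < det3 (hat a) (hat b) (hat c) →
      0 ≤ det3 (hat a) (hat b) w → 0 ≤ det3 (hat b) (hat c) w → 0 ≤ det3 (hat c) (hat a) w →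
      0 < det3 (hat a) (hat b) w + det3 (hat b) (hat c) w + det3 (hat c) (hat a) w →
      ∃ r : ℝ, 0 < r ∧ ∃ y ∈ convexHull ℝ S, w = r • hat y := by
    intro a ha b hb c hc hD h₁ h₂ h₃ hsum
    have hw := det3_cramer (hat a) (hat b) (hat c) w
    generalize det3 (hat a) (hat b) (hat c) = D at *
    generalize det3 (hat a) (hat b) w = γ at *
    generalize det3 (hat b) (hat c) w = α at *
    generalize det3 (hat c) (hat a) w = β at *
    refine ⟨(γ + α + β) / D, by positivity, (α / (γ + α + β)) • a + (β / (γ + α + β)) • b +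
      (γ / (γ + α + β)) • c, ?_, ?_⟩
    · have hS := subset_convexHull ℝ S
      have := (convex_convexHull ℝ S).sum_mem (t := Finset.univ)
        (w := ![α / (γ + α + β), β / (γ + α + β), γ / (γ + α + β)]) (z := ![a, b, c])
        (by intro i _; fin_cases i <;> simp <;> positivity)
        (by simp [Fin.sum_univ_three]; field_simp; ring)
        (by intro i _; fin_cases i <;> simp <;> exact hS (by assumption))
      simpa [Fin.sum_univ_three] using this
    · ext i
      have := congrFun hw i
      fin_cases i <;> simp [hat] at this ⊢ <;> field_simp <;> linarith
  have hac : det3 (hat c) (hat a) w = -det3 (hat a) (hat c) w := by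
    simp [det3, Matrix.det_fin_three]; ring
  rcases le_total 0 (det3 (hat a) (hat c) w) with h | h
  · exact tri a ha c hc d hd hacd h hcd.le hda (by linarith)
  · exact tri a ha b hb c hc habc hab hbc.le (by linarith) (by linarith)

theorem mem_convexHull_range_iff_exists_stdSimplex {ι E : Type*} [Fintype ι] [AddCommGroup E]
    [Module ℝ E] (v : ι → E) (x : E) :
    x ∈ convexHull ℝ (Set.range v) ↔ ∃ w ∈ stdSimplex ℝ ι, ∑ i, w i • v i = x := by
  classical
  constructor
  · intro hx
    have hc : Convex ℝ (Fintype.linearCombination ℝ v '' stdSimplex ℝ ι) :=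
      (convex_stdSimplex ℝ ι).linear_image _
    refine convexHull_min ?_ hc hx
    rintro _ ⟨i, rfl⟩
    exact ⟨Pi.single i 1, single_mem_stdSimplex ℝ i, by simp⟩
  · rintro ⟨w, hw, rfl⟩
    exact mem_convexHull_of_exists_fintype w v hw.1 hw.2 (fun i => ⟨i, rfl⟩) rfl

/-- The affine point and height represented by a vector `u` on the level `e`. -/
noncomputable def dehomogenize (e : ℝ) (u : Fin 3 → ℝ) : (Fin 2 → ℝ) × ℝ :=
  (![u 0 / u 2, u 1 / u 2], e / u 2)

/-- The plane section of the hull of points above and below the plane, in homogeneous coordinates,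
is spanned by the sums of the vectors above and the vectors below. -/
theorem mem_convexHull_dehomogenize_iff {S : Set (Fin 2 → ℝ)} {u v : Fin 3 → Fin 3 → ℝ}
    (hu : ∀ i, 0 < u i 2) (hv : ∀ j, 0 < v j 2)
    (huv : ∀ i j, ∃ r : ℝ, 0 < r ∧ ∃ y ∈ convexHull ℝ S, u i + v j = r • hat y)
    (hS : ∀ y ∈ S, ∃ i j, ∃ r : ℝ, 0 < r ∧ u i + v j = r • hat y) (x : Fin 2 → ℝ) :
    (x, (0 : ℝ)) ∈ convexHull ℝ (Set.range
        (Sum.elim (fun i => dehomogenize 1 (u i)) fun j => dehomogenize (-1) (v j))) ↔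
      x ∈ convexHull ℝ S := by
  constructor
  · intro hx
    obtain ⟨w, hw, hwx⟩ := (mem_convexHull_range_iff_exists_stdSimplex _ _).1 hx
    choose r hr y hy e using huv
    let α : Fin 3 → ℝ := fun i => w (.inl i) / u i 2
    let β : Fin 3 → ℝ := fun j => w (.inr j) / v j 2
    have hα : ∀ i, 0 ≤ α i := fun i => div_nonneg (hw.1 _) (hu i).le
    have hβ : ∀ j, 0 ≤ β j := fun j => div_nonneg (hw.1 _) (hv j).le
    have hone : ∑ i, α i * u i 2 + ∑ j, β j * v j 2 = 1 := by
      rw [← hw.2, Fintype.sum_sum_type]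
      congr 1 <;> refine Finset.sum_congr rfl fun i _ => div_mul_cancel₀ _ ?_
      exacts [(hu i).ne', (hv i).ne']
    have hlevel : ∑ i, α i = ∑ j, β j := by
      have := congrArg Prod.snd hwx
      simp [Fintype.sum_sum_type, dehomogenize, Prod.snd_sum] at this
      simp only [α, β, div_eq_mul_inv, neg_mul, one_mul, mul_neg, Finset.sum_neg_distrib] at this ⊢
      linarith
    have h0 : ∑ i, α i * u i 0 + ∑ j, β j * v j 0 = x 0 := by
      have := congrArg (fun p => p.1 0) hwx
      simp [Fintype.sum_sum_type, dehomogenize, Prod.fst_sum] at this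
      simp only [α, β]
      rw [← this]
      congr 1 <;> refine Finset.sum_congr rfl fun i _ => by ring
    have h1 : ∑ i, α i * u i 1 + ∑ j, β j * v j 1 = x 1 := by
      have := congrArg (fun p => p.1 1) hwx
      simp [Fintype.sum_sum_type, dehomogenize, Prod.fst_sum] at this
      simp only [α, β]
      rw [← this]
      congr 1 <;> refine Finset.sum_congr rfl fun i _ => by ring
    have hpos : 0 < ∑ i, α i := by
      refine (Finset.sum_nonneg fun i _ => hα i).lt_of_ne fun h => ?_
      have za := (Finset.sum_eq_zero_iff_of_nonneg fun i _ => hα i).1 h.symm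
      have zb := (Finset.sum_eq_zero_iff_of_nonneg fun i _ => hβ i).1 (hlevel ▸ h.symm)
      simp only [Finset.mem_univ, true_imp_iff] at za zb
      simp [za, zb] at hone
    have expand : ∀ f g : Fin 3 → ℝ,
        ∑ p : Fin 3 × Fin 3, α p.1 * β p.2 / (∑ i, α i) * (f p.1 + g p.2) =
          ∑ i, α i * f i + ∑ j, β j * g j := by
      intro f g
      have : ∑ p : Fin 3 × Fin 3, α p.1 * β p.2 / (∑ i, α i) * (f p.1 + g p.2) =
          ((∑ j, β j) * (∑ i, α i * f i) + (∑ i, α i) * (∑ j, β j * g j)) / ∑ i, α i := by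
        simp only [Fintype.sum_prod_type, Fin.sum_univ_three]
        ring
      rw [this, ← hlevel, ← mul_add, mul_div_cancel_left₀ _ hpos.ne']
    have hmem := (convex_convexHull ℝ S).sum_mem (t := Finset.univ)
      (w := fun p : Fin 3 × Fin 3 => α p.1 * β p.2 / (∑ i, α i) * r p.1 p.2)
      (z := fun p => y p.1 p.2)
      (fun p _ => mul_nonneg (div_nonneg (mul_nonneg (hα _) (hβ _)) hpos.le) (hr _ _).le)
      (by
        rw [← hone, ← expand]
        refine Finset.sum_congr rfl fun p _ => ?_
        have := congrFun (e p.1 p.2) 2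
        simp [hat] at this
        rw [this])
      (fun p _ => hy _ _)
    convert hmem using 1
    ext k
    fin_cases k
    · simp only [Fin.zero_eta, Finset.sum_apply, Pi.smul_apply, smul_eq_mul]
      rw [← h0, ← expand]
      refine Finset.sum_congr rfl fun p _ => ?_
      have := congrFun (e p.1 p.2) 0
      simp [hat] at this
      rw [this]; ring
    · simp only [Fin.mk_one, Finset.sum_apply, Pi.smul_apply, smul_eq_mul]
      rw [← h1, ← expand]
      refine Finset.sum_congr rfl fun p _ => ?_
      have := congrFun (e p.1 p.2) 1
      simp [hat] at this
      rw [this]; ring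
  · intro hx
    set R := Set.range
      (Sum.elim (fun i => dehomogenize 1 (u i)) fun j => dehomogenize (-1) (v j))
    refine convexHull_min (fun y hy => ?_)
      ((convex_convexHull ℝ R).linear_preimage (LinearMap.inl ℝ (Fin 2 → ℝ) ℝ)) hx
    obtain ⟨i, j, r, hr, e⟩ := hS y hy
    have e0 := congrFun e 0
    have e1 := congrFun e 1
    have e2 := congrFun e 2
    simp [hat] at e0 e1 e2
    have hui := hu i
    have hvj := hv j
    have := (convex_convexHull ℝ R) (subset_convexHull ℝ R ⟨.inl i, rfl⟩)
      (subset_convexHull ℝ R ⟨.inr j, rfl⟩) (div_nonneg hui.le hr.le) (div_nonneg hvj.le hr.le)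
      (by rw [← add_div, e2, div_self hr.ne'])
    change (y, (0 : ℝ)) ∈ convexHull ℝ R
    convert this using 1
    simp only [Sum.elim_inl, Sum.elim_inr, dehomogenize]
    ext k
    · fin_cases k <;> simp <;> field_simp <;> linarith
    · simp
      field_simp
      ring

theorem PosOriented.exists_section_of_liftable {q : Fin 7 → Fin 2 → ℝ}
    (hq : PosOriented fun i => hat (q i)) (hl : Liftable fun i => hat (q i)) :
    ∃ v : Fin 3 ⊕ Fin 3 → (Fin 2 → ℝ) × ℝ, ∀ x,
      (x, (0 : ℝ)) ∈ convexHull ℝ (Set.range v) ↔ x ∈ convexHull ℝ (Set.range q) := by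
  obtain ⟨hl₁, hl₂⟩ := hl
  have P : ∀ i j k : Fin 7, i < j → j < k → 0 < det3 (hat (q i)) (hat (q j)) (hat (q k)) := hq
  have p012 := P 0 1 2 (by decide) (by decide)
  have p013 := P 0 1 3 (by decide) (by decide)
  have p023 := P 0 2 3 (by decide) (by decide)
  have p123 := P 1 2 3 (by decide) (by decide)
  have p014 := P 0 1 4 (by decide) (by decide)
  have p134 := P 1 3 4 (by decide) (by decide)
  have p234 := P 2 3 4 (by decide) (by decide)
  have p036 := P 0 3 6 (by decide) (by decide)
  have p345 := P 3 4 5 (by decide) (by decide)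
  have p346 := P 3 4 6 (by decide) (by decide)
  have p456 := P 4 5 6 (by decide) (by decide)
  have p045 := P 0 4 5 (by decide) (by decide)
  have p046 := P 0 4 6 (by decide) (by decide)
  have p056 := P 0 5 6 (by decide) (by decide)
  rw [show det3 (hat (q 5)) (hat (q 6)) (hat (q 0)) = det3 (hat (q 0)) (hat (q 5)) (hat (q 6)) from
    det3_rotate ..] at hl₁ hl₂
  have E₁ : det3 (hat (q 1)) (hat (q 2)) (hat (q 3)) • hat (q 0) +
      det3 (hat (q 0)) (hat (q 1)) (hat (q 3)) • hat (q 2) =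
      det3 (hat (q 0)) (hat (q 2)) (hat (q 3)) • hat (q 1) +
      det3 (hat (q 0)) (hat (q 1)) (hat (q 2)) • hat (q 3) := by
    ext k; fin_cases k <;> simp [det3, Matrix.det_fin_three] <;> ring
  have E₂ : det3 (hat (q 4)) (hat (q 5)) (hat (q 6)) • hat (q 0) +
      det3 (hat (q 0)) (hat (q 4)) (hat (q 6)) • hat (q 5) =
      det3 (hat (q 0)) (hat (q 4)) (hat (q 5)) • hat (q 6) +
      det3 (hat (q 0)) (hat (q 5)) (hat (q 6)) • hat (q 4) := by
    ext k; fin_cases k <;> simp [det3, Matrix.det_fin_three] <;> ring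
  set K := det3 (hat (q 1)) (hat (q 2)) (hat (q 3)) * det3 (hat (q 4)) (hat (q 5)) (hat (q 6))
    with hK
  set l₁ := det3 (hat (q 0)) (hat (q 2)) (hat (q 3)) * det3 (hat (q 4)) (hat (q 5)) (hat (q 6))
    with hl1
  set l₂ := det3 (hat (q 0)) (hat (q 1)) (hat (q 3)) * det3 (hat (q 4)) (hat (q 5)) (hat (q 6))
    with hl2
  set l₃ := det3 (hat (q 0)) (hat (q 1)) (hat (q 2)) * det3 (hat (q 4)) (hat (q 5)) (hat (q 6))
    with hl3
  set l₄ := det3 (hat (q 0)) (hat (q 5)) (hat (q 6)) * det3 (hat (q 1)) (hat (q 2)) (hat (q 3))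
    with hl4
  set l₅ := det3 (hat (q 0)) (hat (q 4)) (hat (q 6)) * det3 (hat (q 1)) (hat (q 2)) (hat (q 3))
    with hl5
  set l₆ := det3 (hat (q 0)) (hat (q 4)) (hat (q 5)) * det3 (hat (q 1)) (hat (q 2)) (hat (q 3))
    with hl6
  have K0 : 0 < K := mul_pos p123 p456
  have l10 : 0 < l₁ := mul_pos p023 p456
  have l20 : 0 < l₂ := mul_pos p013 p456
  have l30 : 0 < l₃ := mul_pos p012 p456
  have l40 : 0 < l₄ := mul_pos p056 p123
  have l50 : 0 < l₅ := mul_pos p046 p123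
  have l60 : 0 < l₆ := mul_pos p045 p123
  have F₁ : ∀ k, K * hat (q 0) k + l₂ * hat (q 2) k = l₁ * hat (q 1) k + l₃ * hat (q 3) k :=
    fun k => by
      have := congrFun E₁ k
      simp only [Pi.add_apply, Pi.smul_apply, smul_eq_mul] at this
      rw [hK, hl1, hl2, hl3]
      linear_combination det3 (hat (q 4)) (hat (q 5)) (hat (q 6)) * this
  have F₂ : ∀ k, K * hat (q 0) k + l₅ * hat (q 5) k = l₆ * hat (q 6) k + l₄ * hat (q 4) k :=
    fun k => by
      have := congrFun E₂ k
      simp only [Pi.add_apply, Pi.smul_apply, smul_eq_mul] at this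
      rw [hK, hl4, hl5, hl6]
      linear_combination det3 (hat (q 1)) (hat (q 2)) (hat (q 3)) * this
  have hS : ∀ i, q i ∈ Set.range q := fun i => ⟨i, rfl⟩
  have s0 := det3_self_left
  have s1 := det3_self_right
  obtain ⟨r₁, hr₁, y₁, hy₁, e₁⟩ : ∃ r : ℝ, 0 < r ∧ ∃ y ∈ convexHull ℝ (Set.range q),
      l₂ • hat (q 2) - l₃ • hat (q 3) + l₄ • hat (q 4) = r • hat y := by
    have e : l₂ • hat (q 2) - l₃ • hat (q 3) + l₄ • hat (q 4) =
        l₁ • hat (q 1) - K • hat (q 0) + l₄ • hat (q 4) := by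
      ext k; simp; linarith [F₁ k]
    refine exists_smul_hat_of_det3_nonneg (hS 1) (hS 2) (hS 3) (hS 4) p123 p134 ?_ ?_ ?_ ?_
    · rw [det3_smul_sub_add_smul, s1, hl3, hl4]
      nlinarith
    · rw [det3_smul_sub_add_smul, s0, s1]
      have := mul_pos l40 p234
      linarith
    · rw [det3_smul_sub_add_smul, s0, s1, det3_rotate]
      have := mul_pos l20 p234
      linarith
    · rw [e, det3_smul_sub_add_smul, s0, s1, det3_reverse]
      have := mul_pos K0 p014
      linarith
  obtain ⟨r₂, hr₂, y₂, hy₂, e₂⟩ : ∃ r : ℝ, 0 < r ∧ ∃ y ∈ convexHull ℝ (Set.range q),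
      l₃ • hat (q 3) - l₄ • hat (q 4) + l₅ • hat (q 5) = r • hat y := by
    have e : l₃ • hat (q 3) - l₄ • hat (q 4) + l₅ • hat (q 5) =
        l₃ • hat (q 3) - K • hat (q 0) + l₆ • hat (q 6) := by
      ext k; simp; linarith [F₂ k]
    refine exists_smul_hat_of_det3_nonneg (hS 6) (hS 3) (hS 4) (hS 5)
      (by rwa [det3_rotate, det3_rotate]) (by rwa [det3_rotate, det3_rotate]) ?_ ?_ ?_ ?_
    · rw [e, det3_smul_sub_add_smul, s0, s1, det3_reverse]
      have := mul_pos K0 p036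
      linarith
    · rw [det3_smul_sub_add_smul, s0, s1]
      have := mul_pos l50 p345
      linarith
    · rw [det3_smul_sub_add_smul, s0, s1, det3_rotate]
      have := mul_pos l30 p345
      linarith
    · rw [det3_smul_sub_add_smul, s0, det3_rotate (hat (q 3)), det3_rotate (hat (q 4)), hl3, hl4]
      nlinarith
  have t₁ : l₂ - l₃ + l₄ = r₁ := by simpa [hat] using congrFun e₁ 2
  have t₂ : l₃ - l₄ + l₅ = r₂ := by simpa [hat] using congrFun e₂ 2
  have f₁ : K + l₂ = l₁ + l₃ := by simpa [hat] using F₁ 2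
  have f₂ : K + l₅ = l₆ + l₄ := by simpa [hat] using F₂ 2
  obtain ⟨τ, hτ, hτ'⟩ : ∃ τ, max 0 (max (K - l₁) (K - l₆)) < τ ∧ τ < min K (min l₃ l₄) := by
    refine exists_between ?_
    simp only [lt_min_iff, max_lt_iff]
    refine ⟨⟨?_, ?_, ?_⟩, ⟨?_, ?_, ?_⟩, ?_, ?_, ?_⟩ <;> linarith
  simp only [lt_min_iff, max_lt_iff] at hτ hτ'
  obtain ⟨b, rfl⟩ : ∃ b : Fin 3 → ℝ, b 2 = τ := ⟨fun _ => τ, rfl⟩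
  obtain ⟨h0, h1, h6⟩ := hτ
  obtain ⟨hK', h3, h4⟩ := hτ'
  have hat_two : ∀ p, hat p 2 = 1 := fun _ => rfl
  refine ⟨_, mem_convexHull_dehomogenize_iff
    (u := ![K • hat (q 0) - b, l₃ • hat (q 3) - b, l₄ • hat (q 4) - b])
    (v := ![l₁ • hat (q 1) - K • hat (q 0) + b, b,
      l₆ • hat (q 6) - K • hat (q 0) + b]) ?_ ?_ ?_ ?_⟩
  · intro i; fin_cases i <;> simp [hat_two] <;> linarith
  · intro i; fin_cases i <;> simp [hat_two] <;> linarith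
  · have hc : ∀ i, q i ∈ convexHull ℝ (Set.range q) := fun i => subset_convexHull ℝ _ (hS i)
    intro i j
    fin_cases i <;> fin_cases j
    · exact ⟨l₁, l10, q 1, hc 1, by ext k; simp⟩
    · exact ⟨K, K0, q 0, hc 0, by ext k; simp⟩
    · exact ⟨l₆, l60, q 6, hc 6, by ext k; simp⟩
    · exact ⟨l₂, l20, q 2, hc 2, by ext k; simp; linarith [F₁ k]⟩
    · exact ⟨l₃, l30, q 3, hc 3, by ext k; simp⟩
    · refine ⟨r₂, hr₂, y₂, hy₂, ?_⟩
      rw [← e₂]; ext k; simp; linarith [F₂ k]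
    · refine ⟨r₁, hr₁, y₁, hy₁, ?_⟩
      rw [← e₁]; ext k; simp; linarith [F₁ k]
    · exact ⟨l₄, l40, q 4, hc 4, by ext k; simp⟩
    · exact ⟨l₅, l50, q 5, hc 5, by ext k; simp; linarith [F₂ k]⟩
  · rintro _ ⟨i, rfl⟩
    fin_cases i
    · exact ⟨0, 1, K, K0, by ext k; simp⟩
    · exact ⟨0, 0, l₁, l10, by ext k; simp⟩
    · exact ⟨1, 0, l₂, l20, by ext k; simp; linarith [F₁ k]⟩
    · exact ⟨1, 1, l₃, l30, by ext k; simp⟩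
    · exact ⟨2, 1, l₄, l40, by ext k; simp⟩
    · exact ⟨2, 2, l₅, l50, by ext k; simp; linarith [F₂ k]⟩
    · exact ⟨0, 2, l₆, l60, by ext k; simp⟩

/-- Every heptagon is a plane section of the convex hull of six points in space. -/
theorem exists_heptagon_section (q : Fin 7 → Fin 2 → ℝ)
    (hq : ∀ i j k, i < j → j < k → det3 (hat (q i)) (hat (q j)) (hat (q k)) < 0) :
    ∃ v : Fin 3 ⊕ Fin 3 → (Fin 2 → ℝ) × ℝ, ∀ x,
      (x, (0 : ℝ)) ∈ convexHull ℝ (Set.range v) ↔ x ∈ convexHull ℝ (Set.range q) := by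
  have hpos : PosOriented fun i => hat (q i.rev) := by
    intro i j k hij hjk
    have := hq k.rev j.rev i.rev (Fin.rev_lt_rev.2 hjk) (Fin.rev_lt_rev.2 hij)
    rw [det3_reverse] at this
    linarith
  obtain ⟨s, hs⟩ := hpos.exists_liftable
  obtain ⟨v, hv⟩ := PosOriented.exists_section_of_liftable (q := fun i => q (i + s).rev)
    (hpos.rotate s) hs
  have : Set.range (fun i => q (i + s).rev) = Set.range q :=
    EquivLike.range_comp q ((Equiv.addRight s).trans Fin.revPerm)
  exact ⟨v, by simpa only [this] using hv⟩

/-- The plane times one of the coordinate axes of the complement. -/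
noncomputable def axisEmbedding {k : ℕ} (g : Fin k) :
    (Fin 2 → ℝ) × ℝ →ₗ[ℝ] (Fin (2 + k) → ℝ) where
  toFun p := Fin.append p.1 (Pi.single g p.2)
  map_add' p r := by
    ext i; refine Fin.addCases (fun i => ?_) (fun i => ?_) i <;> simp [Pi.single_add]
  map_smul' c p := by
    ext i; refine Fin.addCases (fun i => ?_) (fun i => ?_) i <;> simp [Pi.single_apply]

/-- The plane as the coordinate plane of the first two coordinates. -/
noncomputable def planeEmbedding (k : ℕ) : (Fin 2 → ℝ) →ₗ[ℝ] (Fin (2 + k) → ℝ) where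
  toFun p := Fin.append p 0
  map_add' p r := by
    ext i; refine Fin.addCases (fun i => ?_) (fun i => ?_) i <;> simp
  map_smul' c p := by
    ext i; refine Fin.addCases (fun i => ?_) (fun i => ?_) i <;> simp

theorem axisEmbedding_apply {k : ℕ} (g : Fin k) (p : (Fin 2 → ℝ) × ℝ) :
    axisEmbedding g p = Fin.append p.1 (Pi.single g p.2) := rfl

theorem planeEmbedding_apply {k : ℕ} (p : Fin 2 → ℝ) :
    planeEmbedding k p = Fin.append p 0 := rfl

/-- Gluing plane sections of spatial polytopes along their common plane, together with further
points of that plane. -/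
theorem convexHull_inter_range_planeEmbedding {k r m : ℕ} {ι : Type*} [Fintype ι]
    {p : Fin m → Fin 2 → ℝ} {c : Fin k → Set (Fin 2 → ℝ)} {v : Fin k → ι → (Fin 2 → ℝ) × ℝ}
    {b : Fin r → Fin 2 → ℝ}
    (hv : ∀ g x, (x, (0 : ℝ)) ∈ convexHull ℝ (Set.range (v g)) ↔ x ∈ convexHull ℝ (c g))
    (hne : (Set.range p).Nonempty) (hp : Set.range p = (⋃ g, c g) ∪ Set.range b) :
    convexHull ℝ (Set.range (Sum.elim (fun i : Fin k × ι => axisEmbedding i.1 (v i.1 i.2))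
        fun i => planeEmbedding k (b i))) ∩ Set.range (planeEmbedding k) =
      planeEmbedding k '' convexHull ℝ (Set.range p) := by
  apply Set.Subset.antisymm
  · rintro _ ⟨hy, y, rfl⟩
    refine ⟨y, ?_, rfl⟩
    obtain ⟨w, hw, hwy⟩ := (mem_convexHull_range_iff_exists_stdSimplex _ _).1 hy
    rw [Fintype.sum_sum_type, Fintype.sum_prod_type] at hwy
    simp only [Sum.elim_inl, Sum.elim_inr] at hwy
    have hsum := hw.2
    rw [Fintype.sum_sum_type, Fintype.sum_prod_type] at hsum
    have hlevel : ∀ g, ∑ i, w (.inl (g, i)) * (v g i).2 = 0 := fun g => by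
      have := congrFun hwy (Fin.natAdd 2 g)
      simpa [axisEmbedding_apply, planeEmbedding_apply, Finset.sum_apply, Pi.single_apply,
        Finset.sum_ite_eq] using this
    have hplane : ∑ g, ∑ i, w (.inl (g, i)) • (v g i).1 + ∑ i, w (.inr i) • b i = y := by
      ext l
      have := congrFun hwy (Fin.castAdd k l)
      simpa [axisEmbedding_apply, planeEmbedding_apply, Finset.sum_apply] using this
    have part : ∀ g, ∃ z ∈ convexHull ℝ (Set.range p),
        ∑ i, w (.inl (g, i)) • (v g i).1 = (∑ i, w (.inl (g, i))) • z := fun g => by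
      have hw0 : ∀ i, 0 ≤ w (.inl (g, i)) := fun i => hw.1 _
      rcases (Finset.sum_nonneg fun i _ => hw0 i).eq_or_lt' with h | h
      · have h' := (Finset.sum_eq_zero_iff_of_nonneg fun i _ => hw0 i).1 h
        obtain ⟨z, hz⟩ := hne.convexHull (𝕜 := ℝ)
        refine ⟨z, hz, ?_⟩
        rw [h, zero_smul]
        exact Finset.sum_eq_zero fun i hi => by rw [h' i hi, zero_smul]
      · have hm := Finset.univ.centerMass_mem_convexHull (s := Set.range (v g)) (z := v g)
          (w := fun i => w (.inl (g, i))) (fun i _ => hw0 i) h fun i _ => ⟨i, rfl⟩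
        set z := Finset.univ.centerMass (fun i => w (.inl (g, i))) (v g) with hz
        have hz' : (∑ i, w (.inl (g, i))) • z = ∑ i, w (.inl (g, i)) • v g i := by
          rw [hz, Finset.centerMass, smul_inv_smul₀ h.ne']
        have hz2 : z.2 = 0 := by
          have := congrArg Prod.snd hz'
          simp only [Prod.snd_sum, Prod.smul_snd, smul_eq_mul, hlevel] at this
          exact (mul_eq_zero.1 this).resolve_left h.ne'
        refine ⟨z.1, convexHull_mono ?_ ((hv g z.1).1 (hz2 ▸ hm)), ?_⟩
        · exact hp ▸ (Set.subset_iUnion c g).trans Set.subset_union_left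
        · have := congrArg Prod.fst hz'
          simpa only [Prod.fst_sum, Prod.smul_fst] using this.symm
    choose z hz hwz using part
    have hm := (convex_convexHull ℝ (Set.range p)).sum_mem (t := Finset.univ)
      (w := Sum.elim (fun g => ∑ i, w (.inl (g, i))) fun i => w (.inr i)) (z := Sum.elim z b)
      (by
        rintro (g | i) -
        · exact Finset.sum_nonneg fun i _ => hw.1 _
        · exact hw.1 _)
      (by simpa [Fintype.sum_sum_type] using hsum)
      (by
        rintro (g | i) -
        · exact hz g
        · exact subset_convexHull ℝ _ (hp ▸ Or.inr ⟨i, rfl⟩))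
    simpa [Fintype.sum_sum_type, ← hwz, hplane] using hm
  · rintro _ ⟨y, hy, rfl⟩
    refine ⟨?_, y, rfl⟩
    refine convexHull_min ?_ ((convex_convexHull ℝ _).linear_preimage (planeEmbedding k)) hy
    rw [hp]
    refine Set.union_subset (Set.iUnion_subset fun g x hx => ?_) ?_
    · have h := (hv g x).2 (subset_convexHull ℝ _ hx)
      have e : planeEmbedding k x = axisEmbedding g (x, 0) := by
        simp [planeEmbedding_apply, axisEmbedding_apply]
      rw [Set.mem_preimage, e]
      have h' := Set.mem_image_of_mem (axisEmbedding g) h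
      rw [LinearMap.image_convexHull] at h'
      refine convexHull_mono ?_ h'
      rintro _ ⟨_, ⟨i, rfl⟩, rfl⟩
      exact ⟨.inl (g, i), rfl⟩
    · rintro _ ⟨i, rfl⟩
      exact subset_convexHull ℝ _ ⟨.inr i, rfl⟩

/-- Every `n`-gon with `n ≥ 7` is a section of a `(2 + ⌊n/7⌋)`-dimensional polytope
with at most `⌈6n/7⌉` vertices.  (In ℕ, `⌊n/7⌋ = n / 7` and `⌈6n/7⌉ = (6n + 6) / 7`.) -/
theorem ngon_section_dimension_and_vertices
    (n : ℕ) (hn : 7 ≤ n) (p : Fin n → Fin 2 → ℝ)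
    (hconv : ∀ i j k : Fin n, i < j → j < k →
      det3 (hat (p i)) (hat (p j)) (hat (p k)) < 0) :
    ∃ (V : Finset (Fin (2 + n / 7) → ℝ))
      (f : (Fin 2 → ℝ) →ᵃ[ℝ] (Fin (2 + n / 7) → ℝ)),
      V.card ≤ (6 * n + 6) / 7 ∧ Function.Injective f ∧
      convexHull ℝ (V : Set (Fin (2 + n / 7) → ℝ)) ∩ Set.range f =
        f '' (convexHull ℝ (Set.range p)) := by
  have hg : ∀ (g : Fin (n / 7)) (j : Fin 7), 7 * g.val + j.val < n := fun g j => by omega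
  have hb : ∀ i : Fin (n % 7), 7 * (n / 7) + i.val < n := fun i => by omega
  let q : Fin (n / 7) → Fin 7 → Fin 2 → ℝ := fun g j => p ⟨7 * g + j, hg g j⟩
  let b : Fin (n % 7) → Fin 2 → ℝ := fun i => p ⟨7 * (n / 7) + i, hb i⟩
  have hp : Set.range p = (⋃ g, Set.range (q g)) ∪ Set.range b := by
    apply Set.Subset.antisymm
    · rintro _ ⟨i, rfl⟩
      rcases lt_or_ge (i.val / 7) (n / 7) with h | h
      · refine Or.inl (Set.mem_iUnion.2 ⟨⟨i / 7, h⟩, ⟨i % 7, by omega⟩, ?_⟩)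
        exact congrArg p (Fin.ext (by simp; omega))
      · refine Or.inr ⟨⟨i - 7 * (n / 7), by omega⟩, ?_⟩
        exact congrArg p (Fin.ext (by simp; omega))
    · refine Set.union_subset (Set.iUnion_subset fun g => ?_) ?_ <;> rintro _ ⟨i, rfl⟩ <;>
        exact ⟨_, rfl⟩
  choose v hv using fun g => exists_heptagon_section (q g) fun i j k hij hjk =>
    hconv _ _ _ (by simpa using hij) (by simpa using hjk)
  classical
  refine ⟨Finset.univ.image (Sum.elim
    (fun i : Fin (n / 7) × (Fin 3 ⊕ Fin 3) => axisEmbedding i.1 (v i.1 i.2))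
    fun i => planeEmbedding (n / 7) (b i)), (planeEmbedding (n / 7)).toAffineMap, ?_, ?_, ?_⟩
  · refine Finset.card_image_le.trans ?_
    simp only [Finset.card_univ, Fintype.card_sum, Fintype.card_prod, Fintype.card_fin]
    omega
  · intro x y h
    ext l
    simpa [planeEmbedding_apply] using congrFun h (Fin.castAdd (n / 7) l)
  · rw [Finset.coe_image, Finset.coe_univ, Set.image_univ]
    exact convexHull_inter_range_planeEmbedding hv ⟨_, ⟨0, by omega⟩, rfl⟩ hp
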